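/- Let X be a spectrally negative Lévy process. For every q > 0, b > 0 and every positive bounded measurable function f : ℝ → [0,∞), 𝔼[∫_0^{τ_b^+} e^{−qt} f(X_t) dt] = ∫_{−∞}^{b} f(y) ( e^{−Φ(q)b} W^{(q)}(b−y) − W^{(q)}(−y) ) dy. -/

import Mathlib

open MeasureTheory ProbabilityTheory Set Filter
open scoped ENNReal

noncomputable section

/-- A spectrally negative Lévy process: a family of laws `P x` (the process started at `x`),
the process `X`, its left limits `Xlim`, Laplace exponent `ψ`, right inverse `Φ`,
Gaussian coefficient `σ2`, Lévy measure `levyMeasure`, and the scale functions `W` together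
with (a version of) their derivatives/densities `W'`. -/
structure SNLevy (Ω : Type) [MeasurableSpace Ω] where
  P : ℝ → Measure Ω
  probP : ∀ x, IsProbabilityMeasure (P x)
  X : ℝ → Ω → ℝ
  measX : ∀ t : ℝ, Measurable (X t)
  start : ∀ x : ℝ, ∀ᵐ ω ∂ P x, X 0 ω = x
  rightCont : ∀ x : ℝ, ∀ᵐ ω ∂ P x, ∀ t : ℝ, 0 ≤ t →
      Filter.Tendsto (fun s => X s ω) (nhdsWithin t (Set.Ioi t)) (nhds (X t ω))
  Xlim : ℝ → Ω → ℝ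
  leftLimit : ∀ x : ℝ, ∀ᵐ ω ∂ P x, ∀ t : ℝ, 0 < t →
      Filter.Tendsto (fun s => X s ω) (nhdsWithin t (Set.Iio t)) (nhds (Xlim t ω))
  spatialHom : ∀ x t : ℝ, 0 ≤ t → (P x).map (X t) = (P 0).map (fun ω => x + X t ω)
  stationaryInc : ∀ x s t : ℝ, 0 ≤ s → 0 ≤ t →
      (P x).map (fun ω => X (s + t) ω - X s ω) = (P 0).map (X t)
  indepInc : ∀ x s t : ℝ, 0 ≤ s → 0 ≤ t →
      ProbabilityTheory.Indep
        (MeasurableSpace.comap (fun ω => X (s + t) ω - X s ω) inferInstance)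
        (⨆ u ∈ Set.Icc (0 : ℝ) s, MeasurableSpace.comap (X u) inferInstance) (P x)
  noPosJumps : ∀ x : ℝ, ∀ᵐ ω ∂ P x, ∀ t : ℝ, 0 < t → X t ω ≤ Xlim t ω
  notNegSubordinator : ¬ (∀ᵐ ω ∂ P 0, ∀ s t : ℝ, 0 ≤ s → s ≤ t → X t ω ≤ X s ω)
  ψ : ℝ → ℝ
  laplaceExp : ∀ lam : ℝ, 0 ≤ lam → ∀ t : ℝ, 0 ≤ t →
      ∫ ω, Real.exp (lam * X t ω) ∂ P 0 = Real.exp (ψ lam * t)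
  Φ : ℝ → ℝ
  Φdef : ∀ θ : ℝ, 0 ≤ θ → Φ θ = sSup {lam : ℝ | 0 ≤ lam ∧ ψ lam = θ}
  γ : ℝ
  σ2 : ℝ
  σ2nonneg : 0 ≤ σ2
  levyMeasure : Measure ℝ
  levySupp : levyMeasure (Set.Ici 0) = 0
  levyInt : ∫⁻ y, ENNReal.ofReal (min 1 (y ^ 2)) ∂levyMeasure ≠ ∞
  levyKhintchine : ∀ lam : ℝ, 0 ≤ lam →
      ψ lam = γ * lam + σ2 / 2 * lam ^ 2 +
        ∫ y, (Real.exp (lam * y) - 1 - lam * y * (if -1 < y then 1 else 0)) ∂levyMeasure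
  W : ℝ → ℝ → ℝ
  Wnonneg : ∀ θ : ℝ, 0 ≤ θ → ∀ y : ℝ, 0 ≤ W θ y
  Wzero : ∀ θ : ℝ, 0 ≤ θ → ∀ y : ℝ, y < 0 → W θ y = 0
  Wcont : ∀ θ : ℝ, 0 ≤ θ → ContinuousOn (W θ) (Set.Ioi 0)
  Wmeas : ∀ θ : ℝ, 0 ≤ θ → Measurable (W θ)
  Wlaplace : ∀ θ : ℝ, 0 ≤ θ → ∀ lam : ℝ, Φ θ < lam →
      ∫ y in Set.Ioi (0 : ℝ), Real.exp (-lam * y) * W θ y = 1 / (ψ lam - θ)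
  Wuniq : ∀ θ : ℝ, 0 ≤ θ → ∀ V : ℝ → ℝ, ContinuousOn V (Set.Ioi 0) →
      (∀ lam : ℝ, Φ θ < lam →
        ∫ y in Set.Ioi (0 : ℝ), Real.exp (-lam * y) * V y = 1 / (ψ lam - θ)) →
      Set.EqOn V (W θ) (Set.Ioi 0)
  W' : ℝ → ℝ → ℝ
  Wabscont : ∀ θ : ℝ, 0 ≤ θ → ∀ y : ℝ, 0 ≤ y →
      W θ y = W θ 0 + ∫ z in Set.Ioc (0 : ℝ) y, W' θ z

namespace SNLevy

variable {Ω : Type} [MeasurableSpace Ω] (L : SNLevy Ω)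

/-- First passage time above level `a`: `τ_a^+ = inf {t > 0 : X_t > a}`, valued in `ℝ≥0∞`
(`⊤` when the level is never passed). -/
def tauAbove (a : ℝ) (ω : Ω) : ℝ≥0∞ :=
  sInf {t : ℝ≥0∞ | t ≠ ⊤ ∧ 0 < t ∧ a < L.X t.toReal ω}

/-- First passage time below level `a`: `τ_a^- = inf {t > 0 : X_t < a}`. -/
def tauBelow (a : ℝ) (ω : Ω) : ℝ≥0∞ :=
  sInf {t : ℝ≥0∞ | t ≠ ⊤ ∧ 0 < t ∧ L.X t.toReal ω < a}

/-- `𝒲^{(θ)}(a,x,y) = W^{(θ)}(x) W^{(θ)}(a-y)/W^{(θ)}(a) - W^{(θ)}(x-y)`. -/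
def scrW (θ a x y : ℝ) : ℝ :=
  L.W θ x * L.W θ (a - y) / L.W θ a - L.W θ (x - y)

/-- `𝒪^{(θ)}(a,x) = W^{(θ)'}(x) - W^{(θ)}(x) W^{(θ)'}(a)/W^{(θ)}(a)`. -/
def scrO (θ a x : ℝ) : ℝ :=
  L.W' θ x - L.W θ x * L.W' θ a / L.W θ a

/-- `H^{(θ)}(b,x) = W^{(θ)}(b-x)/W^{(θ)}(b) - e^{Φ(θ)b} W^{(θ)}(-x)/W^{(θ)}(b)`. -/
def H (θ b x : ℝ) : ℝ :=
  L.W θ (b - x) / L.W θ b - Real.exp (L.Φ θ * b) * L.W θ (-x) / L.W θ b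

end SNLevy

/-- `e^{-q t} 1_{t < ∞}` for an extended-real time `t`. -/
def eNeg (q : ℝ) (t : ℝ≥0∞) : ℝ :=
  if t = ⊤ then 0 else Real.exp (-q * t.toReal)

open Topology in
lemma ext_of_exp_integrals (μ ν : Measure ℝ) [IsFiniteMeasure μ] [IsFiniteMeasure ν] (ε : ℝ) (hε : 0 < ε)
    (hμ : ∀ s, -ε < s → s < ε → Integrable (fun y => Real.exp (s * y)) μ)
    (hν : ∀ s, -ε < s → s < ε → Integrable (fun y => Real.exp (s * y)) ν)
    (h : ∀ s, -ε < s → s < ε → ∫ y, Real.exp (s * y) ∂μ = ∫ y, Real.exp (s * y) ∂ν) : μ = ν := by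
  have hsub : ∀ (κ : Measure ℝ), (∀ s, -ε < s → s < ε → Integrable (fun y => Real.exp (s * y)) κ) →
      Ioo (-ε) ε ⊆ interior (integrableExpSet id κ) := by
    intro κ hκ
    refine interior_maximal ?_ isOpen_Ioo
    intro s hs
    exact hκ s hs.1 hs.2
  have hX : AnalyticOnNhd ℂ (complexMGF id μ) {z | z.re ∈ Ioo (-ε) ε} :=
    analyticOnNhd_complexMGF.mono fun z hz => hsub μ hμ hz
  have hY : AnalyticOnNhd ℂ (complexMGF id ν) {z | z.re ∈ Ioo (-ε) ε} :=
    analyticOnNhd_complexMGF.mono fun z hz => hsub ν hν hz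
  have key : Set.EqOn (complexMGF id μ) (complexMGF id ν) {z | z.re ∈ Ioo (-ε) ε} := by
    refine AnalyticOnNhd.eqOn_of_preconnected_of_frequently_eq hX hY
      ((convex_Ioo (-ε) ε).linear_preimage Complex.reLm).isPreconnected
      (z₀ := ((0:ℝ) : ℂ)) (by simp [hε]) ?_
    have h_real : ∃ᶠ (x : ℝ) in 𝓝[≠] 0, complexMGF id μ x = complexMGF id ν x := by
      refine Eventually.frequently ?_
      have : Ioo (-ε) ε ∈ 𝓝[≠] (0:ℝ) := mem_nhdsWithin_of_mem_nhds (Ioo_mem_nhds (by linarith) hε)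
      filter_upwards [this] with x hx
      rw [complexMGF_ofReal, complexMGF_ofReal]
      congr 1
      exact h x hx.1 hx.2
    rw [frequently_iff_seq_forall] at h_real ⊢
    obtain ⟨xs, hx_tendsto, hx_eq⟩ := h_real
    refine ⟨fun n ↦ xs n, ?_, fun n ↦ ?_⟩
    · rw [tendsto_nhdsWithin_iff] at hx_tendsto ⊢
      constructor
      · exact (Complex.continuous_ofReal.tendsto 0).comp hx_tendsto.1
      · simpa using hx_tendsto.2
    · simp [hx_eq]
  apply Measure.ext_of_charFun
  ext t
  rw [← complexMGF_id_mul_I, ← complexMGF_id_mul_I]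
  apply key
  simp [hε]

open Topology in
/-- joint measurability of right-continuous processes -/
lemma joint_meas {Ω : Type} [MeasurableSpace Ω] (Z : ℝ → Ω → ℝ) (hm : ∀ t, Measurable (Z t))
    (hrc : ∀ ω, ∀ t : ℝ, 0 ≤ t → Tendsto (fun s => Z s ω) (𝓝[>] t) (𝓝 (Z t ω))) :
    Measurable (fun p : ℝ × Ω => Z (max p.1 0) p.2) := by
  have hg : ∀ n : ℕ, Measurable (fun p : ℝ × Ω => Z ((⌊(n + 1 : ℝ) * max p.1 0⌋₊ + 1 : ℝ) / (n + 1)) p.2) := by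
    intro n
    have h1 : Measurable (fun p : ℕ × Ω => Z ((p.1 + 1 : ℝ) / (n + 1)) p.2) :=
      measurable_from_prod_countable_right fun k => hm ((k + 1 : ℝ) / (n + 1))
    have h2 : Measurable (fun p : ℝ × Ω => (⌊(n + 1 : ℝ) * max p.1 0⌋₊, p.2)) := by
      refine Measurable.prodMk ?_ measurable_snd
      exact Nat.measurable_floor.comp (by fun_prop)
    exact h1.comp h2
  refine measurable_of_tendsto_metrizable hg ?_
  rw [tendsto_pi_nhds]
  rintro ⟨t, ω⟩
  refine (hrc ω (max t 0) (le_max_right _ _)).comp ?_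
  rw [tendsto_nhdsWithin_iff]
  have ht : 0 ≤ max t 0 := le_max_right _ _
  have low : ∀ n : ℕ, max t 0 < (⌊(n + 1 : ℝ) * max t 0⌋₊ + 1 : ℝ) / (n + 1) := by
    intro n
    rw [lt_div_iff₀ (by positivity), mul_comm]
    exact Nat.lt_floor_add_one _
  refine ⟨?_, Eventually.of_forall low⟩
  refine tendsto_of_tendsto_of_tendsto_of_le_of_le tendsto_const_nhds (h := fun n : ℕ => max t 0 + 1 / ((n : ℝ) + 1)) ?_
    (fun n => (low n).le) ?_
  · have := (tendsto_const_nhds (x := max t 0) (f := (atTop : Filter ℕ))).add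
      (tendsto_one_div_add_atTop_nhds_zero_nat (𝕜 := ℝ))
    rwa [add_zero] at this
  · intro n
    have := Nat.floor_le (a := (n + 1 : ℝ) * max t 0) (by positivity)
    simp only
    rw [div_le_iff₀ (by positivity)]
    field_simp
    linarith

namespace SNLevy
open Topology

variable {Ω : Type} [MeasurableSpace Ω] (L : SNLevy Ω)

lemma integrable_exp {lam t : ℝ} (hl : 0 ≤ lam) (ht : 0 ≤ t) :
    Integrable (fun ω => Real.exp (lam * L.X t ω)) (L.P 0) := by
  by_contra h
  have := L.laplaceExp lam hl t ht
  rw [integral_undef h] at this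
  exact (Real.exp_pos _).ne this

lemma lintegral_exp {lam t : ℝ} (hl : 0 ≤ lam) (ht : 0 ≤ t) :
    ∫⁻ ω, ENNReal.ofReal (Real.exp (lam * L.X t ω)) ∂(L.P 0) = ENNReal.ofReal (Real.exp (L.ψ lam * t)) := by
  rw [← L.laplaceExp lam hl t ht, ofReal_integral_eq_lintegral_ofReal (L.integrable_exp hl ht)]
  exact ae_of_all _ fun ω => (Real.exp_pos _).le

lemma psi_eq_log {lam : ℝ} (hl : 0 ≤ lam) :
    L.ψ lam = Real.log (∫ ω, Real.exp (lam * L.X 1 ω) ∂ L.P 0) := by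
  rw [L.laplaceExp lam hl 1 zero_le_one]; simp

lemma psi_zero : L.ψ 0 = 0 := by
  have := L.probP 0
  rw [L.psi_eq_log le_rfl]; simp

lemma psi_cont (N : ℝ) : ContinuousOn L.ψ (Icc 0 N) := by
  have := L.probP 0
  rcases lt_or_ge N 0 with hN | hN
  · simp [Icc_eq_empty (not_le.2 hN)]
  have h1 : ContinuousOn (fun lam => ∫ ω, Real.exp (lam * L.X 1 ω) ∂ L.P 0) (Icc 0 N) := by
    refine continuousOn_of_dominated (bound := fun ω => 1 + Real.exp (N * L.X 1 ω)) ?_ ?_ ?_ ?_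
    · intro x hx
      exact (L.integrable_exp hx.1 zero_le_one).aestronglyMeasurable
    · intro x hx
      refine ae_of_all _ fun ω => ?_
      rw [Real.norm_eq_abs, abs_of_pos (Real.exp_pos _)]
      rcases le_total (L.X 1 ω) 0 with h | h
      · have : Real.exp (x * L.X 1 ω) ≤ 1 := Real.exp_le_one_iff.2 (mul_nonpos_of_nonneg_of_nonpos hx.1 h)
        have := Real.exp_pos (N * L.X 1 ω)
        linarith
      · have : Real.exp (x * L.X 1 ω) ≤ Real.exp (N * L.X 1 ω) :=
          Real.exp_le_exp.2 (mul_le_mul_of_nonneg_right hx.2 h)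
        linarith
    · exact (integrable_const _).add (L.integrable_exp hN zero_le_one)
    · refine ae_of_all _ fun ω => ?_
      fun_prop
  have h2 : ContinuousOn (fun lam => Real.log (∫ ω, Real.exp (lam * L.X 1 ω) ∂ L.P 0)) (Icc 0 N) := by
    refine h1.log fun x hx => ?_
    rw [L.laplaceExp x hx.1 1 zero_le_one]
    exact (Real.exp_pos _).ne'
  exact h2.congr fun x hx => L.psi_eq_log hx.1

lemma exists_pos : ∃ t : ℝ, 0 ≤ t ∧ L.P 0 {ω | 0 < L.X t ω} ≠ 0 := by
  by_contra! hcon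
  apply L.notNegSubordinator
  have hinc : ∀ s t : ℝ, 0 ≤ s → s ≤ t → ∀ᵐ ω ∂ L.P 0, L.X t ω ≤ L.X s ω := by
    intro s t hs hst
    have h := L.stationaryInc 0 s (t - s) hs (by linarith)
    have h2 := congrArg (fun m => m (Ioi 0)) h
    rw [Measure.map_apply (show Measurable (fun ω => L.X (s + (t - s)) ω - L.X s ω) from
        (L.measX _).sub (L.measX _)) measurableSet_Ioi,
      Measure.map_apply (L.measX _) measurableSet_Ioi] at h2
    have h3 := hcon (t - s) (by linarith)
    rw [show L.X (t - s) ⁻¹' Ioi 0 = {ω | 0 < L.X (t - s) ω} from rfl, h3] at h2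
    have h4 : ∀ᵐ ω ∂ L.P 0, ¬ (0 < L.X t ω - L.X s ω) := by
      rw [ae_iff]
      convert h2 using 2
      ext ω; simp
    filter_upwards [h4] with ω hω
    linarith
  have hq : ∀ᵐ ω ∂ L.P 0, ∀ r₁ r₂ : ℚ, 0 ≤ r₁ → r₁ ≤ r₂ → L.X r₂ ω ≤ L.X r₁ ω := by
    rw [ae_all_iff]; intro r₁
    rw [ae_all_iff]; intro r₂
    by_cases h : 0 ≤ r₁ ∧ r₁ ≤ r₂
    · filter_upwards [hinc r₁ r₂ (by exact_mod_cast h.1) (by exact_mod_cast h.2)] with ω hω _ _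
      exact hω
    · exact ae_of_all _ fun ω h1 h2 => absurd ⟨h1, h2⟩ h
  filter_upwards [hq, L.rightCont 0] with ω hω hrc s t hs hst
  rcases hst.eq_or_lt with rfl | hst
  · exact le_rfl
  -- first: rational below
  have step : ∀ r : ℚ, s < r → L.X r ω ≤ L.X s ω := by
    intro r hr
    by_contra! hlt
    have h1 := (hrc s hs).eventually (gt_mem_nhds hlt)
    have h2 : ∀ᶠ u in 𝓝[>] s, u ∈ Ioo s (r:ℝ) := Ioo_mem_nhdsGT hr
    obtain ⟨v, hv, hsub⟩ := (mem_nhdsGT_iff_exists_Ioo_subset).1 (h1.and h2)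
    obtain ⟨r', hr1, hr2⟩ := exists_rat_btwn (mem_Ioi.1 hv)
    have h3 := hsub ⟨hr1, hr2⟩
    have h4 := hω r' r (by exact_mod_cast (hs.trans hr1.le)) (by exact_mod_cast h3.2.2.le)
    have h5 : L.X r' ω < L.X r ω := h3.1
    linarith
  by_contra! hlt
  have h1 := (hrc t (hs.trans hst.le)).eventually (lt_mem_nhds hlt)
  obtain ⟨v, hv, hsub⟩ := (mem_nhdsGT_iff_exists_Ioo_subset).1 h1
  obtain ⟨r', hr1, hr2⟩ := exists_rat_btwn (mem_Ioi.1 hv)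
  have h3 : L.X s ω < L.X r' ω := hsub ⟨hr1, hr2⟩
  have h4 := step r' (hst.trans hr1)
  linarith

lemma psi_growth (q : ℝ) : ∃ N : ℝ, 0 ≤ N ∧ ∀ lam, N ≤ lam → q < L.ψ lam := by
  have := L.probP 0
  obtain ⟨t, ht, hp⟩ := L.exists_pos
  have ht0 : 0 < t := by
    rcases ht.eq_or_lt with rfl | h
    · exfalso
      apply hp
      have := L.start 0
      rw [ae_iff] at this
      refine measure_mono_null ?_ this
      intro ω (hω : 0 < L.X 0 ω)
      exact hω.ne'
    · exact h
  have : ∃ n : ℕ, L.P 0 {ω | 1 / ((n:ℝ) + 1) < L.X t ω} ≠ 0 := by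
    by_contra! hcon
    apply hp
    have : {ω | 0 < L.X t ω} ⊆ ⋃ n : ℕ, {ω | 1 / ((n:ℝ) + 1) < L.X t ω} := by
      intro ω hω
      obtain ⟨n, hn⟩ := exists_nat_one_div_lt (show 0 < L.X t ω from hω)
      exact mem_iUnion.2 ⟨n, hn⟩
    exact measure_mono_null this (measure_iUnion_null hcon)
  obtain ⟨n, hn⟩ := this
  set δ : ℝ := 1 / ((n:ℝ) + 1) with hδ
  have hδ0 : 0 < δ := by positivity
  set A := {ω | δ < L.X t ω} with hA
  have hAm : MeasurableSet A := measurableSet_lt measurable_const (L.measX t)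
  set p := (L.P 0).real A with hpdef
  have hp0 : 0 < p := by
    rw [hpdef, measureReal_def]
    exact ENNReal.toReal_pos hn (measure_ne_top _ _)
  refine ⟨max 0 ((q * t - Real.log p) / δ + 1), le_max_left _ _, fun lam hl => ?_⟩
  have hl0 : 0 ≤ lam := (le_max_left _ _).trans hl
  have hl1 := (le_max_right _ _).trans hl
  have key : p * Real.exp (lam * δ) ≤ Real.exp (L.ψ lam * t) := by
    rw [← L.laplaceExp lam hl0 t ht]
    calc p * Real.exp (lam * δ) = ∫ ω in A, Real.exp (lam * δ) ∂ L.P 0 := by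
          rw [setIntegral_const, smul_eq_mul]
      _ ≤ ∫ ω in A, Real.exp (lam * L.X t ω) ∂ L.P 0 := by
          refine setIntegral_mono_on (integrable_const _) (L.integrable_exp hl0 ht).integrableOn hAm ?_
          intro ω hω
          exact Real.exp_le_exp.2 (mul_le_mul_of_nonneg_left (le_of_lt hω) hl0)
      _ ≤ _ := setIntegral_le_integral (L.integrable_exp hl0 ht)
          (ae_of_all _ fun ω => (Real.exp_pos _).le)
  have h2 := Real.log_le_log (by positivity) key
  rw [Real.log_mul hp0.ne' (Real.exp_pos _).ne', Real.log_exp, Real.log_exp] at h2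
  have h3 : (q * t - Real.log p) / δ < lam := by linarith
  rw [div_lt_iff₀ hδ0] at h3
  have : q * t < L.ψ lam * t := by linarith
  exact lt_of_mul_lt_mul_right this ht

lemma Phi_spec {q : ℝ} (hq : 0 < q) :
    0 < L.Φ q ∧ L.ψ (L.Φ q) = q ∧ ∀ lam, L.Φ q < lam → q < L.ψ lam := by
  obtain ⟨N, hN, hgr⟩ := L.psi_growth q
  set S := {lam : ℝ | 0 ≤ lam ∧ L.ψ lam = q} with hS
  have hΦ : L.Φ q = sSup S := L.Φdef q hq.le
  have hsub : S = Icc 0 N ∩ L.ψ ⁻¹' {q} := by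
    ext x
    simp only [hS, mem_ofPred_eq, mem_inter_iff, mem_Icc, mem_preimage, mem_singleton_iff]
    constructor
    · rintro ⟨h1, h2⟩
      refine ⟨⟨h1, ?_⟩, h2⟩
      by_contra! h
      have := hgr x h.le
      linarith
    · rintro ⟨⟨h1, _⟩, h2⟩
      exact ⟨h1, h2⟩
  have hcl : IsClosed S := by
    rw [hsub]
    exact (L.psi_cont N).preimage_isClosed_of_isClosed isClosed_Icc isClosed_singleton
  have hcomp : IsCompact S := by
    refine isCompact_Icc.of_isClosed_subset hcl (s := Icc 0 N) ?_
    rw [hsub]; exact inter_subset_left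
  have hne : S.Nonempty := by
    have := intermediate_value_Icc hN (L.psi_cont N)
    have h2 : q ∈ Icc (L.ψ 0) (L.ψ N) := ⟨by rw [L.psi_zero]; exact hq.le, (hgr N le_rfl).le⟩
    obtain ⟨x, hx, hx2⟩ := this h2
    exact ⟨x, hx.1, hx2⟩
  have hmem := hcomp.sSup_mem hne
  rw [← hΦ] at hmem
  have hpos : 0 < L.Φ q := by
    refine lt_of_le_of_ne hmem.1 ?_
    intro h
    have := hmem.2
    rw [← h, L.psi_zero] at this
    linarith
  refine ⟨hpos, hmem.2, ?_⟩
  intro lam hlam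
  have hnot : L.ψ lam ≠ q := by
    intro h
    have : lam ≤ sSup S := le_csSup hcomp.bddAbove ⟨hpos.le.trans hlam.le, h⟩
    rw [← hΦ] at this
    linarith
  have h1 := L.Wlaplace q hq.le lam hlam
  have h2 : 0 ≤ 1 / (L.ψ lam - q) := by
    rw [← h1]
    exact integral_nonneg fun y => mul_nonneg (Real.exp_pos _).le (L.Wnonneg q hq.le y)
  have h3 : 0 ≤ L.ψ lam - q := by
    rwa [one_div, inv_nonneg] at h2
  exact lt_of_le_of_ne (by linarith) (Ne.symm hnot)

end SNLevy

namespace SNLevy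
open Topology

variable {Ω : Type} [MeasurableSpace Ω] (L : SNLevy Ω)

/-- first passage over rational times -/
def tauQ (b : ℝ) (ω : Ω) : ℝ≥0∞ :=
  ⨅ r : ℚ, if 0 < r ∧ b < L.X r ω then ENNReal.ofReal r else ⊤

/-- good paths -/
def Good (ω : Ω) : Prop :=
  L.X 0 ω = 0 ∧ (∀ t : ℝ, 0 ≤ t → Tendsto (fun s => L.X s ω) (𝓝[>] t) (𝓝 (L.X t ω))) ∧
  (∀ t : ℝ, 0 < t → Tendsto (fun s => L.X s ω) (𝓝[<] t) (𝓝 (L.Xlim t ω))) ∧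
  (∀ t : ℝ, 0 < t → L.X t ω ≤ L.Xlim t ω)

lemma ae_good : ∀ᵐ ω ∂ L.P 0, L.Good ω := by
  filter_upwards [L.start 0, L.rightCont 0, L.leftLimit 0, L.noPosJumps 0] with ω h1 h2 h3 h4
  exact ⟨h1, h2, h3, h4⟩

lemma tauQ_lt_iff (b : ℝ) (ω : Ω) (s : ℝ≥0∞) :
    L.tauQ b ω < s ↔ ∃ r : ℚ, 0 < r ∧ b < L.X r ω ∧ ENNReal.ofReal r < s := by
  unfold tauQ
  rw [iInf_lt_iff]
  refine exists_congr fun r => ?_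
  split_ifs with h
  · simp [h.1, h.2]
  · simp only [not_top_lt, false_iff]
    rintro ⟨h1, h2, _⟩
    exact h ⟨h1, h2⟩

lemma measurable_tauQ (b : ℝ) : Measurable (L.tauQ b) := by
  unfold tauQ
  refine Measurable.iInf fun r => ?_
  refine Measurable.ite ?_ measurable_const measurable_const
  exact (MeasurableSet.const (0 < r)).inter (measurableSet_lt measurable_const (L.measX r))

lemma tauQ_meas_filt (b : ℝ) (t : ℝ) :
    MeasurableSet[⨆ u ∈ Set.Icc (0 : ℝ) t, MeasurableSpace.comap (L.X u) inferInstance]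
      {ω | L.tauQ b ω < ENNReal.ofReal t} := by
  have : {ω | L.tauQ b ω < ENNReal.ofReal t} =
      ⋃ r : ℚ, ⋃ (_ : 0 < r ∧ (r:ℝ) < t), L.X r ⁻¹' (Ioi b) := by
    ext ω
    simp only [mem_ofPred_eq, mem_iUnion, mem_preimage, mem_Ioi, exists_prop, tauQ_lt_iff]
    refine exists_congr fun r => ?_
    constructor
    · rintro ⟨h1, h2, h3⟩
      rw [ENNReal.ofReal_lt_ofReal_iff_of_nonneg (by exact_mod_cast h1.le)] at h3
      exact ⟨⟨h1, h3⟩, h2⟩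
    · rintro ⟨⟨h1, h3⟩, h2⟩
      refine ⟨h1, h2, ?_⟩
      rwa [ENNReal.ofReal_lt_ofReal_iff_of_nonneg (by exact_mod_cast h1.le)]
  rw [this]
  refine MeasurableSet.iUnion fun r => MeasurableSet.iUnion fun hr => ?_
  have hle : MeasurableSpace.comap (L.X r) inferInstance ≤
      ⨆ u ∈ Set.Icc (0 : ℝ) t, MeasurableSpace.comap (L.X u) inferInstance :=
    le_iSup₂_of_le (r:ℝ) ⟨by exact_mod_cast hr.1.le, hr.2.le⟩ le_rfl
  exact hle _ ⟨Ioi b, measurableSet_Ioi, rfl⟩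

variable {L}

lemma exists_rat_of_gt {ω : Ω} (h : L.Good ω) {s b v : ℝ} (hs : 0 ≤ s) (hb : b < L.X s ω) (hv : s < v) :
    ∃ r : ℚ, s < r ∧ (r : ℝ) < v ∧ b < L.X r ω := by
  have h1 := (h.2.1 s hs).eventually (lt_mem_nhds hb)
  have h2 : ∀ᶠ u in 𝓝[>] s, u ∈ Ioo s v := Ioo_mem_nhdsGT hv
  obtain ⟨w, hw, hsub⟩ := (mem_nhdsGT_iff_exists_Ioo_subset).1 (h1.and h2)
  obtain ⟨r', hr1, hr2⟩ := exists_rat_btwn (mem_Ioi.1 hw)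
  have h3 := hsub ⟨hr1, hr2⟩
  exact ⟨r', hr1, h3.2.2, h3.1⟩

lemma X_le_of_lt {ω : Ω} (h : L.Good ω) {s b : ℝ} (hs : 0 ≤ s)
    (hlt : ENNReal.ofReal s < L.tauQ b ω) : L.X s ω ≤ b := by
  by_contra! hb
  obtain ⟨x, hx1, hx2⟩ := ENNReal.lt_iff_exists_nnreal_btwn.1 hlt
  have hsx : s < x := by
    rw [← ENNReal.ofReal_coe_nnreal] at hx1
    exact (ENNReal.ofReal_lt_ofReal_iff_of_nonneg hs).1 hx1
  obtain ⟨r, h1, h2, h3⟩ := exists_rat_of_gt h hs hb hsx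
  have h4 : L.tauQ b ω < x := by
    rw [tauQ_lt_iff]
    refine ⟨r, by exact_mod_cast hs.trans_lt h1, h3, ?_⟩
    rw [← ENNReal.ofReal_coe_nnreal]
    exact (ENNReal.ofReal_lt_ofReal_iff_of_nonneg (hs.trans h1.le)).2 h2
  exact absurd h4 (not_lt.2 hx2.le)

lemma tauAbove_eq {ω : Ω} (h : L.Good ω) (b : ℝ) : L.tauAbove b ω = L.tauQ b ω := by
  apply le_antisymm
  · refine le_of_forall_gt fun s hs => ?_
    rw [tauQ_lt_iff] at hs
    obtain ⟨r, h1, h2, h3⟩ := hs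
    have hr : (0:ℝ) < r := by exact_mod_cast h1
    refine lt_of_le_of_lt (sInf_le ⟨ENNReal.ofReal_ne_top, ENNReal.ofReal_pos.2 hr, ?_⟩) h3
    rwa [ENNReal.toReal_ofReal hr.le]
  · refine le_sInf ?_
    rintro t ⟨ht, ht0, hb⟩
    by_contra! hlt
    rw [← ENNReal.ofReal_toReal ht] at hlt
    have := X_le_of_lt h ENNReal.toReal_nonneg hlt
    linarith

lemma X_tau {ω : Ω} (h : L.Good ω) {b : ℝ} (hb : 0 < b) (ht : L.tauQ b ω ≠ ⊤) :
    L.X (L.tauQ b ω).toReal ω = b := by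
  set τ := (L.tauQ b ω).toReal with hτ
  have hτ0 : 0 ≤ τ := ENNReal.toReal_nonneg
  have hτe : L.tauQ b ω = ENNReal.ofReal τ := (ENNReal.ofReal_toReal ht).symm
  have hge : b ≤ L.X τ ω := by
    by_contra! hlt
    have h1 := (h.2.1 τ hτ0).eventually (gt_mem_nhds hlt)
    obtain ⟨w, hw, hsub⟩ := (mem_nhdsGT_iff_exists_Ioo_subset).1 h1
    have h2 : L.tauQ b ω < ENNReal.ofReal w := by
      rw [hτe]
      exact (ENNReal.ofReal_lt_ofReal_iff_of_nonneg hτ0).2 hw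
    rw [tauQ_lt_iff] at h2
    obtain ⟨r, r1, r2, r3⟩ := h2
    have hr : (0:ℝ) < r := by exact_mod_cast r1
    rw [ENNReal.ofReal_lt_ofReal_iff_of_nonneg hr.le] at r3
    rcases lt_trichotomy τ (r:ℝ) with h5 | h5 | h5
    · have : L.X r ω < b := hsub ⟨h5, r3⟩
      linarith
    · rw [← h5] at r2; linarith
    · have := X_le_of_lt h (b := b) hr.le (by rw [hτe]; exact (ENNReal.ofReal_lt_ofReal_iff_of_nonneg hr.le).2 h5)
      linarith
  have hpos : 0 < τ := by
    rcases hτ0.eq_or_lt with h0 | h0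
    · rw [← h0, h.1] at hge; linarith
    · exact h0
  refine le_antisymm ((h.2.2.2 τ hpos).trans ?_) hge
  refine le_of_tendsto (h.2.2.1 τ hpos) ?_
  filter_upwards [Ioo_mem_nhdsLT hpos] with s hs
  exact X_le_of_lt h hs.1.le (by rw [hτe]; exact (ENNReal.ofReal_lt_ofReal_iff_of_nonneg hs.1.le).2 hs.2)

lemma X_le_of_le {ω : Ω} (h : L.Good ω) {s b : ℝ} (hb : 0 < b) (hs : 0 ≤ s)
    (hle : ENNReal.ofReal s ≤ L.tauQ b ω) : L.X s ω ≤ b := by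
  rcases hle.eq_or_lt with h1 | h1
  · have := X_tau h hb (by rw [← h1]; exact ENNReal.ofReal_ne_top)
    rw [← h1, ENNReal.toReal_ofReal hs] at this
    exact this.le
  · exact X_le_of_lt h hs h1

variable (L)

/-- exponential martingale -/
def M (lam t : ℝ) (ω : Ω) : ℝ≥0∞ := ENNReal.ofReal (Real.exp (lam * L.X t ω - L.ψ lam * t))

lemma measurable_M (lam t : ℝ) : Measurable (L.M lam t) := by
  have := L.measX t
  unfold M
  fun_prop

lemma lintegral_M {lam t : ℝ} (hl : 0 ≤ lam) (ht : 0 ≤ t) : ∫⁻ ω, L.M lam t ω ∂ L.P 0 = 1 := by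
  have : ∀ ω, L.M lam t ω = ENNReal.ofReal (Real.exp (lam * L.X t ω)) * ENNReal.ofReal (Real.exp (-(L.ψ lam * t))) := by
    intro ω
    rw [M, ← ENNReal.ofReal_mul (Real.exp_pos _).le, ← Real.exp_add]; rfl
  simp_rw [this]
  rw [lintegral_mul_const' _ _ ENNReal.ofReal_ne_top, L.lintegral_exp hl ht,
    ← ENNReal.ofReal_mul (Real.exp_pos _).le, ← Real.exp_add]
  simp

lemma martingale {lam s t : ℝ} (hl : 0 ≤ lam) (hs : 0 ≤ s) (hst : s ≤ t) (A : Set Ω)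
    (hA : MeasurableSet[⨆ u ∈ Set.Icc (0 : ℝ) s, MeasurableSpace.comap (L.X u) inferInstance] A) :
    ∫⁻ ω in A, L.M lam t ω ∂ L.P 0 = ∫⁻ ω in A, L.M lam s ω ∂ L.P 0 := by
  have hle : (⨆ u ∈ Set.Icc (0 : ℝ) s, MeasurableSpace.comap (L.X u) inferInstance) ≤ ‹MeasurableSpace Ω› :=
    iSup₂_le fun u _ => (L.measX u).comap_le
  have hA' : MeasurableSet A := hle _ hA
  have hinc : Measurable (fun ω => L.X (s + (t - s)) ω - L.X s ω) := (L.measX _).sub (L.measX _)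
  have hind := L.indepInc 0 s (t - s) hs (by linarith)
  have hXs : Measurable[⨆ u ∈ Set.Icc (0 : ℝ) s, MeasurableSpace.comap (L.X u) inferInstance] (L.X s) := by
    have h1 : Measurable[MeasurableSpace.comap (L.X s) inferInstance] (L.X s) := comap_measurable _
    exact h1.mono (le_iSup₂_of_le s ⟨hs, le_rfl⟩ le_rfl) le_rfl
  have hgm : Measurable[⨆ u ∈ Set.Icc (0 : ℝ) s, MeasurableSpace.comap (L.X u) inferInstance]
      (A.indicator (L.M lam s)) := by
    refine Measurable.indicator ?_ hA
    have : Measurable (fun x : ℝ => ENNReal.ofReal (Real.exp (lam * x - L.ψ lam * s))) := by fun_prop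
    exact this.comp hXs
  have hfm : Measurable[MeasurableSpace.comap (fun ω => L.X (s + (t - s)) ω - L.X s ω) inferInstance]
      (fun ω => ENNReal.ofReal (Real.exp (lam * (L.X (s + (t - s)) ω - L.X s ω) - L.ψ lam * (t - s)))) := by
    have : Measurable (fun x : ℝ => ENNReal.ofReal (Real.exp (lam * x - L.ψ lam * (t - s)))) := by fun_prop
    exact this.comp (comap_measurable _)
  have hmul := lintegral_mul_eq_lintegral_mul_lintegral_of_independent_measurableSpace
    (hinc.comap_le) hle hind hfm hgm
  have h1 : ∫⁻ ω, ENNReal.ofReal (Real.exp (lam * (L.X (s + (t - s)) ω - L.X s ω) - L.ψ lam * (t - s))) ∂ L.P 0 = 1 := by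
    have hmeas : Measurable (fun x : ℝ => ENNReal.ofReal (Real.exp (lam * x - L.ψ lam * (t - s)))) := by fun_prop
    have e1 := lintegral_map (μ := L.P 0) hmeas hinc
    rw [L.stationaryInc 0 s (t - s) hs (by linarith), lintegral_map hmeas (L.measX _)] at e1
    rw [← e1]
    exact L.lintegral_M hl (by linarith)
  rw [h1, one_mul, lintegral_indicator hA'] at hmul
  rw [← hmul, ← lintegral_indicator hA']
  refine lintegral_congr fun ω => ?_
  by_cases hω : ω ∈ A
  · simp only [indicator_of_mem hω, M]
    rw [← ENNReal.ofReal_mul (Real.exp_pos _).le, ← Real.exp_add, add_sub_cancel]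
    congr 2
    ring
  · simp [hω]

end SNLevy

namespace SNLevy
open Topology

variable {Ω : Type} [MeasurableSpace Ω] (L : SNLevy Ω)

/-- discounted value at passage -/
def v (b lam r : ℝ) (ω : Ω) : ℝ≥0∞ :=
  if L.tauQ b ω = ⊤ then 0 else ENNReal.ofReal (Real.exp (lam * b - r * (L.tauQ b ω).toReal))

lemma measurable_v (b lam r : ℝ) : Measurable (L.v b lam r) := by
  have h := L.measurable_tauQ b
  unfold v
  refine Measurable.ite (h (measurableSet_singleton _)) measurable_const ?_
  have := h.ennreal_toReal
  fun_prop

lemma ae_stop_aux {b t lam : ℝ} (hb : 0 < b) (ht : 0 < t) (K : ℝ) {ω : Ω} (hω : L.Good ω)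
    (hτ : L.tauQ b ω < ENNReal.ofReal t) :
    Tendsto (fun n : ℕ => min (L.M lam ((⌊(n + 1 : ℝ) * (L.tauQ b ω).toReal / t⌋₊ + 1 : ℝ) * t / (n + 1)) ω) (ENNReal.ofReal K))
      atTop (𝓝 (min (L.v b lam (L.ψ lam) ω) (ENNReal.ofReal K))) := by
  have hne : L.tauQ b ω ≠ ⊤ := hτ.ne_top
  refine Tendsto.min ?_ tendsto_const_nhds
  rw [v, if_neg hne]
  have hX := X_tau hω hb hne
  set τ := (L.tauQ b ω).toReal with hτdef
  have hτ0 : 0 ≤ τ := ENNReal.toReal_nonneg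
  have hlim : Tendsto (fun n : ℕ => (⌊(n + 1 : ℝ) * τ / t⌋₊ + 1 : ℝ) * t / (n + 1)) atTop (𝓝[>] τ) := by
    rw [tendsto_nhdsWithin_iff]
    have low : ∀ n : ℕ, τ < (⌊(n + 1 : ℝ) * τ / t⌋₊ + 1 : ℝ) * t / (n + 1) := by
      intro n
      rw [lt_div_iff₀ (by positivity), mul_comm, ← div_lt_iff₀ ht]
      exact Nat.lt_floor_add_one _
    refine ⟨?_, Eventually.of_forall low⟩
    refine tendsto_of_tendsto_of_tendsto_of_le_of_le tendsto_const_nhds (h := fun n : ℕ => τ + t * (1 / ((n : ℝ) + 1))) ?_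
      (fun n => (low n).le) ?_
    · have := (tendsto_const_nhds (x := τ) (f := (atTop : Filter ℕ))).add
        ((tendsto_one_div_add_atTop_nhds_zero_nat (𝕜 := ℝ)).const_mul t)
      rwa [mul_zero, add_zero] at this
    · intro n
      have := Nat.floor_le (a := (n + 1 : ℝ) * τ / t) (by positivity)
      rw [le_div_iff₀ ht] at this
      simp only
      rw [div_le_iff₀ (by positivity)]
      field_simp
      linarith
  have h1 := (hω.2.1 τ hτ0).comp hlim
  rw [hX] at h1
  unfold M
  have h2 := hlim.mono_right nhdsWithin_le_nhds
  refine ENNReal.tendsto_ofReal ((Real.continuous_exp.tendsto _).comp ?_)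
  exact (h1.const_mul lam).sub (h2.const_mul (L.ψ lam))

lemma ennreal_aux {x y k C : ℝ} (hx : 0 ≤ x) (hC : 0 ≤ C) (hk : 0 < k) (h : x ^ 2 ≤ C * y) :
    ENNReal.ofReal x ≤ min (ENNReal.ofReal x) (ENNReal.ofReal k) + ENNReal.ofReal (C / k) * ENNReal.ofReal y := by
  rcases le_total x k with hxk | hxk
  · rw [min_eq_left (ENNReal.ofReal_le_ofReal hxk)]
    exact le_self_add
  · refine le_trans ?_ le_add_self
    rw [← ENNReal.ofReal_mul (by positivity)]
    refine ENNReal.ofReal_le_ofReal ?_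
    rw [div_mul_eq_mul_div, le_div_iff₀ hk]
    nlinarith

lemma stop_bounds {b t lam : ℝ} (hl : 0 ≤ lam) (ht : 0 < t) (n : ℕ) (k : ℝ) (hk : 0 < k) :
    (∫⁻ ω in {ω | L.tauQ b ω < ENNReal.ofReal t},
      min (L.M lam ((⌊(n + 1 : ℝ) * (L.tauQ b ω).toReal / t⌋₊ + 1 : ℝ) * t / (n + 1)) ω) (ENNReal.ofReal k) ∂ L.P 0)
      ≤ ∫⁻ ω in {ω | L.tauQ b ω < ENNReal.ofReal t}, L.M lam t ω ∂ L.P 0 ∧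
    ∫⁻ ω in {ω | L.tauQ b ω < ENNReal.ofReal t}, L.M lam t ω ∂ L.P 0 ≤
    (∫⁻ ω in {ω | L.tauQ b ω < ENNReal.ofReal t},
      min (L.M lam ((⌊(n + 1 : ℝ) * (L.tauQ b ω).toReal / t⌋₊ + 1 : ℝ) * t / (n + 1)) ω) (ENNReal.ofReal k) ∂ L.P 0)
      + ENNReal.ofReal (Real.exp (|L.ψ (2 * lam) - 2 * L.ψ lam| * t) / k) := by
  have hprob := L.probP 0
  set C := Real.exp (|L.ψ (2 * lam) - 2 * L.ψ lam| * t) with hC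
  set E := {ω | L.tauQ b ω < ENNReal.ofReal t} with hE
  set κ : Ω → ℕ := fun ω => ⌊(n + 1 : ℝ) * (L.tauQ b ω).toReal / t⌋₊ with hκ
  have hEm : MeasurableSet E := measurableSet_lt (L.measurable_tauQ b) measurable_const
  have hκm : Measurable κ := by
    have := (L.measurable_tauQ b).ennreal_toReal
    exact Nat.measurable_floor.comp (by fun_prop)
  set A : ℕ → Set Ω := fun k => E ∩ {ω | κ ω = k} with hA
  have hAm : ∀ k, MeasurableSet (A k) := fun k => hEm.inter (hκm (measurableSet_singleton k))
  have hdisj : (↑(Finset.range (n+1)) : Set ℕ).PairwiseDisjoint A := by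
    intro i _ j _ hij
    refine Set.disjoint_left.2 ?_
    rintro ω ⟨_, h1⟩ ⟨_, h2⟩
    exact hij (h1.symm.trans h2)
  have hchar : ∀ ω ∈ E, ∀ r : ℝ, 0 ≤ r → (L.tauQ b ω < ENNReal.ofReal r ↔ (L.tauQ b ω).toReal < r) := by
    intro ω hω r hr
    rw [← ENNReal.lt_ofReal_iff_toReal_lt (hω.ne_top)]
  have hκlt : ∀ ω ∈ E, κ ω < n + 1 := by
    intro ω hω
    have h1 := (hchar ω hω t ht.le).1 hω
    rw [hκ, Nat.floor_lt (by positivity), div_lt_iff₀ ht]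
    push_cast
    exact mul_lt_mul_of_pos_left h1 (by positivity)
  have hEU : E = ⋃ k ∈ Finset.range (n+1), A k := by
    ext ω
    simp only [mem_iUnion, Finset.mem_range, exists_prop]
    constructor
    · intro hω
      exact ⟨κ ω, hκlt ω hω, hω, rfl⟩
    · rintro ⟨k, _, h, _⟩
      exact h
  have hsum : ∀ g : Ω → ℝ≥0∞, ∫⁻ ω in E, g ω ∂ L.P 0 = ∑ k ∈ Finset.range (n+1), ∫⁻ ω in A k, g ω ∂ L.P 0 := by
    intro g
    conv_lhs => rw [hEU]
    exact lintegral_biUnion_finset hdisj (fun k _ => hAm k) g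
  set s : ℕ → ℝ := fun k => (k + 1 : ℝ) * t / (n + 1) with hs
  have hs0 : ∀ k, 0 ≤ s k := fun k => by positivity
  have hst : ∀ k ∈ Finset.range (n+1), s k ≤ t := by
    intro k hk
    have : (k:ℝ) + 1 ≤ n + 1 := by exact_mod_cast Finset.mem_range.1 hk
    rw [hs]
    simp only
    rw [div_le_iff₀ (by positivity), mul_comm]
    exact mul_le_mul_of_nonneg_left this ht.le
  have hAfilt : ∀ k ∈ Finset.range (n+1),
      MeasurableSet[⨆ u ∈ Set.Icc (0 : ℝ) (s k), MeasurableSpace.comap (L.X u) inferInstance] (A k) := by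
    intro k hk
    have hAeq : A k = {ω | L.tauQ b ω < ENNReal.ofReal (s k)} \ {ω | L.tauQ b ω < ENNReal.ofReal ((k:ℝ) * t / (n + 1))} := by
      have hfl : ∀ τ : ℝ, 0 ≤ τ → (⌊(n + 1 : ℝ) * τ / t⌋₊ = k ↔ τ < s k ∧ (k:ℝ) * t / (n + 1) ≤ τ) := by
        intro τ hτ
        rw [Nat.floor_eq_iff (by positivity), hs, and_comm]
        simp only
        rw [div_lt_iff₀ ht, le_div_iff₀ ht, lt_div_iff₀ (by positivity), div_le_iff₀ (by positivity), mul_comm τ]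
      ext ω
      constructor
      · rintro ⟨h1, h2⟩
        have h3 := (hfl _ ENNReal.toReal_nonneg).1 h2
        refine ⟨(hchar ω h1 _ (hs0 k)).2 h3.1, ?_⟩
        intro h4
        have := (hchar ω h1 _ (by positivity)).1 h4
        linarith [h3.2]
      · rintro ⟨h1, h2⟩
        have hω : ω ∈ E := lt_of_lt_of_le (show L.tauQ b ω < _ from h1) (ENNReal.ofReal_le_ofReal (hst k hk))
        refine ⟨hω, (hfl _ ENNReal.toReal_nonneg).2 ⟨(hchar ω hω _ (hs0 k)).1 h1, ?_⟩⟩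
        by_contra! h3
        exact h2 ((hchar ω hω _ (by positivity)).2 h3)
    rw [hAeq]
    refine MeasurableSet.diff (L.tauQ_meas_filt b _) ?_
    have := L.tauQ_meas_filt b ((k:ℝ) * t / (n + 1))
    have hle : (⨆ u ∈ Set.Icc (0 : ℝ) ((k:ℝ) * t / (n + 1)), MeasurableSpace.comap (L.X u) inferInstance) ≤
        ⨆ u ∈ Set.Icc (0 : ℝ) (s k), MeasurableSpace.comap (L.X u) inferInstance := ?_
    · exact hle _ this
    refine biSup_mono fun u hu => ⟨hu.1, hu.2.trans ?_⟩
    rw [hs]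
    simp only
    gcongr
    linarith
  have hmart : ∀ l : ℝ, 0 ≤ l → ∀ k ∈ Finset.range (n+1),
      ∫⁻ ω in A k, L.M l t ω ∂ L.P 0 = ∫⁻ ω in A k, L.M l (s k) ω ∂ L.P 0 := by
    intro l hl k hk
    exact L.martingale hl (hs0 k) (hst k hk) _ (hAfilt k hk)
  have hI : (∫⁻ ω in E, min (L.M lam ((⌊(n + 1 : ℝ) * (L.tauQ b ω).toReal / t⌋₊ + 1 : ℝ) * t / (n + 1)) ω) (ENNReal.ofReal k) ∂ L.P 0)
      = ∑ j ∈ Finset.range (n+1), ∫⁻ ω in A j, min (L.M lam (s j) ω) (ENNReal.ofReal k) ∂ L.P 0 := by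
    rw [hsum]
    refine Finset.sum_congr rfl fun j _ => ?_
    refine setLIntegral_congr_fun (hAm j) ?_
    rintro ω ⟨_, h2⟩
    have h2' : ⌊(n + 1 : ℝ) * (L.tauQ b ω).toReal / t⌋₊ = j := h2
    simp only [h2', hs]
  have ha : ∫⁻ ω in E, L.M lam t ω ∂ L.P 0 = ∑ j ∈ Finset.range (n+1), ∫⁻ ω in A j, L.M lam (s j) ω ∂ L.P 0 := by
    rw [hsum]
    exact Finset.sum_congr rfl fun j hj => hmart lam hl j hj
  rw [hI, ha]
  constructor
  · exact Finset.sum_le_sum fun j _ => lintegral_mono fun ω => min_le_left _ _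
  · calc ∑ j ∈ Finset.range (n+1), ∫⁻ ω in A j, L.M lam (s j) ω ∂ L.P 0
        ≤ ∑ j ∈ Finset.range (n+1), (∫⁻ ω in A j, min (L.M lam (s j) ω) (ENNReal.ofReal k) ∂ L.P 0 +
            ENNReal.ofReal (C / k) * ∫⁻ ω in A j, L.M (2 * lam) (s j) ω ∂ L.P 0) := by
          refine Finset.sum_le_sum fun j hj => ?_
          rw [← lintegral_const_mul _ (L.measurable_M _ _), ← lintegral_add_right _ ((L.measurable_M _ _).const_mul _)]
          refine lintegral_mono fun ω => ?_
          refine ennreal_aux (Real.exp_pos _).le (Real.exp_pos _).le hk ?_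
          rw [hC, ← Real.exp_add, ← Real.exp_nat_mul, Real.exp_le_exp]
          have h1 : (L.ψ (2 * lam) - 2 * L.ψ lam) * s j ≤ |L.ψ (2 * lam) - 2 * L.ψ lam| * t :=
            (mul_le_mul_of_nonneg_right (le_abs_self _) (hs0 j)).trans
              (mul_le_mul_of_nonneg_left (hst j hj) (abs_nonneg _))
          push_cast
          nlinarith
      _ = ∑ j ∈ Finset.range (n+1), ∫⁻ ω in A j, min (L.M lam (s j) ω) (ENNReal.ofReal k) ∂ L.P 0 +
            ENNReal.ofReal (C / k) * ∫⁻ ω in E, L.M (2 * lam) t ω ∂ L.P 0 := by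
          rw [Finset.sum_add_distrib, hsum, ← Finset.mul_sum]
          congr 2
          exact Finset.sum_congr rfl fun j hj => (hmart (2 * lam) (by linarith) j hj).symm
      _ ≤ _ := by
          gcongr
          calc _ ≤ ENNReal.ofReal (C / k) * 1 := by
                gcongr
                rw [← L.lintegral_M (lam := 2 * lam) (t := t) (by linarith) ht.le]
                exact setLIntegral_le_lintegral _ _
            _ = _ := mul_one _

lemma stopd {b t lam : ℝ} (hb : 0 < b) (hl : 0 ≤ lam) (ht : 0 < t) :
    ∫⁻ ω in {ω | L.tauQ b ω < ENNReal.ofReal t}, L.M lam t ω ∂ L.P 0 =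
    ∫⁻ ω in {ω | L.tauQ b ω < ENNReal.ofReal t}, L.v b lam (L.ψ lam) ω ∂ L.P 0 := by
  have hprob := L.probP 0
  set C := Real.exp (|L.ψ (2 * lam) - 2 * L.ψ lam| * t) with hC
  set E := {ω | L.tauQ b ω < ENNReal.ofReal t} with hE
  have hEm : MeasurableSet E := measurableSet_lt (L.measurable_tauQ b) measurable_const
  set K0 := Real.exp (lam * b + |L.ψ lam| * t) with hK0
  have hK0pos : 0 < K0 := Real.exp_pos _
  have hlim : ∀ k : ℝ, 0 < k → K0 ≤ k → Tendsto (fun n : ℕ => ∫⁻ ω in E,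
      min (L.M lam ((⌊(n + 1 : ℝ) * (L.tauQ b ω).toReal / t⌋₊ + 1 : ℝ) * t / (n + 1)) ω) (ENNReal.ofReal k) ∂ L.P 0)
      atTop (𝓝 (∫⁻ ω in E, L.v b lam (L.ψ lam) ω ∂ L.P 0)) := by
    intro k hk hk0
    have e : ∫⁻ ω in E, L.v b lam (L.ψ lam) ω ∂ L.P 0 = ∫⁻ ω in E, min (L.v b lam (L.ψ lam) ω) (ENNReal.ofReal k) ∂ L.P 0 := by
      refine setLIntegral_congr_fun hEm fun ω hω => ?_
      refine (min_eq_left ?_).symm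
      have hne : L.tauQ b ω ≠ ⊤ := LT.lt.ne_top hω
      rw [v, if_neg hne]
      refine ENNReal.ofReal_le_ofReal (le_trans ?_ hk0)
      rw [hK0, Real.exp_le_exp]
      have h1 : (L.tauQ b ω).toReal ≤ t := ((ENNReal.lt_ofReal_iff_toReal_lt hne).1 hω).le
      have h2 : -L.ψ lam * (L.tauQ b ω).toReal ≤ |L.ψ lam| * t :=
        (mul_le_mul_of_nonneg_right (neg_le_abs _) ENNReal.toReal_nonneg).trans
          (mul_le_mul_of_nonneg_left h1 (abs_nonneg _))
      linarith
    rw [e]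
    refine tendsto_lintegral_of_dominated_convergence (fun _ => ENNReal.ofReal k) ?_ ?_ ?_ ?_
    · intro n
      have h1 : Measurable (fun p : ℕ × Ω => L.M lam ((p.1 + 1 : ℝ) * t / (n + 1)) p.2) :=
        measurable_from_prod_countable_right fun k => L.measurable_M lam ((k + 1 : ℝ) * t / (n + 1))
      have h2 : Measurable (fun ω : Ω => (⌊(n + 1 : ℝ) * (L.tauQ b ω).toReal / t⌋₊, ω)) := by
        refine Measurable.prodMk ?_ measurable_id
        have := (L.measurable_tauQ b).ennreal_toReal
        exact Nat.measurable_floor.comp (by fun_prop)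
      exact (h1.comp h2).min measurable_const
    · intro n
      exact ae_of_all _ fun ω => min_le_right _ _
    · rw [lintegral_const]
      exact ENNReal.mul_ne_top ENNReal.ofReal_ne_top (measure_ne_top _ _)
    · rw [ae_restrict_iff' hEm]
      filter_upwards [L.ae_good] with ω hω hτ
      exact L.ae_stop_aux hb ht k hω hτ
  apply le_antisymm
  · have h1 : ∀ m : ℕ, ∫⁻ ω in E, L.M lam t ω ∂ L.P 0 ≤ ∫⁻ ω in E, L.v b lam (L.ψ lam) ω ∂ L.P 0 +
        ENNReal.ofReal (C / (K0 + m)) := by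
      intro m
      refine ge_of_tendsto' ((hlim (K0 + m) (by positivity) (by simp)).add_const _) fun n => ?_
      exact (L.stop_bounds hl ht n (K0 + m) (by positivity)).2
    have h2 : Tendsto (fun m : ℕ => ∫⁻ ω in E, L.v b lam (L.ψ lam) ω ∂ L.P 0 +
        ENNReal.ofReal (C / (K0 + m))) atTop (𝓝 (∫⁻ ω in E, L.v b lam (L.ψ lam) ω ∂ L.P 0 + ENNReal.ofReal 0)) := by
      refine Tendsto.const_add _ (ENNReal.tendsto_ofReal ?_)
      refine tendsto_const_nhds.div_atTop ?_
      exact tendsto_atTop_add_const_left _ _ tendsto_natCast_atTop_atTop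
    rw [ENNReal.ofReal_zero, add_zero] at h2
    exact ge_of_tendsto' h2 h1
  · exact le_of_tendsto' (hlim K0 hK0pos le_rfl) fun n => (L.stop_bounds hl ht n K0 hK0pos).1

end SNLevy

namespace SNLevy
open Topology

variable {Ω : Type} [MeasurableSpace Ω] (L : SNLevy Ω)

lemma stop_add {b t lam : ℝ} (hb : 0 < b) (hl : 0 ≤ lam) (ht : 0 < t) :
    ∫⁻ ω in {ω | L.tauQ b ω < ENNReal.ofReal t}, L.v b lam (L.ψ lam) ω ∂ L.P 0 +
    ∫⁻ ω in {ω | L.tauQ b ω < ENNReal.ofReal t}ᶜ, L.M lam t ω ∂ L.P 0 = 1 := by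
  have hEm : MeasurableSet {ω | L.tauQ b ω < ENNReal.ofReal t} :=
    measurableSet_lt (L.measurable_tauQ b) measurable_const
  rw [← L.stopd hb hl ht, lintegral_add_compl _ hEm, L.lintegral_M hl ht.le]

lemma h_le {b t lam : ℝ} (hb : 0 < b) (hl : 0 ≤ lam) (ht : 0 < t) :
    ∫⁻ ω in {ω | L.tauQ b ω < ENNReal.ofReal t}ᶜ, L.M lam t ω ∂ L.P 0 ≤
      ENNReal.ofReal (Real.exp (lam * b - L.ψ lam * t)) := by
  have := L.probP 0
  have hEm : MeasurableSet {ω | L.tauQ b ω < ENNReal.ofReal t} :=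
    measurableSet_lt (L.measurable_tauQ b) measurable_const
  calc _ ≤ ∫⁻ ω in {ω | L.tauQ b ω < ENNReal.ofReal t}ᶜ, ENNReal.ofReal (Real.exp (lam * b - L.ψ lam * t)) ∂ L.P 0 := by
        refine lintegral_mono_ae ?_
        rw [ae_restrict_iff' hEm.compl]
        filter_upwards [L.ae_good] with ω hω hτ
        refine ENNReal.ofReal_le_ofReal (Real.exp_le_exp.2 ?_)
        have := X_le_of_le hω hb ht.le (not_lt.1 hτ)
        have := mul_le_mul_of_nonneg_left this hl
        linarith
    _ ≤ _ := by
        rw [lintegral_const]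
        rw [Measure.restrict_apply_univ]
        exact mul_le_of_le_one_right' prob_le_one

lemma v_total {b lam : ℝ} (hb : 0 < b) (hl : 0 ≤ lam) (hψ : 0 < L.ψ lam) :
    ∫⁻ ω, L.v b lam (L.ψ lam) ω ∂ L.P 0 = 1 := by
  have hEm : ∀ t, MeasurableSet {ω | L.tauQ b ω < ENNReal.ofReal t} := fun t =>
    measurableSet_lt (L.measurable_tauQ b) measurable_const
  have h1 : Tendsto (fun n : ℕ => ∫⁻ ω in {ω | L.tauQ b ω < ENNReal.ofReal (n + 1)}, L.v b lam (L.ψ lam) ω ∂ L.P 0)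
      atTop (𝓝 (∫⁻ ω, L.v b lam (L.ψ lam) ω ∂ L.P 0)) := by
    simp_rw [← lintegral_indicator (hEm _)]
    refine lintegral_tendsto_of_tendsto_of_monotone ?_ ?_ ?_
    · intro n
      exact ((L.measurable_v _ _ _).indicator (hEm _)).aemeasurable
    · refine ae_of_all _ fun ω n m hnm => ?_
      refine indicator_le_indicator_of_subset ?_ (fun _ => zero_le) ω
      intro ω' hω'
      refine lt_of_lt_of_le (show L.tauQ b ω' < _ from hω') (ENNReal.ofReal_le_ofReal ?_)
      have : (n:ℝ) ≤ m := by exact_mod_cast hnm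
      linarith
    · refine ae_of_all _ fun ω => ?_
      by_cases hτ : L.tauQ b ω = ⊤
      · have : L.v b lam (L.ψ lam) ω = 0 := by rw [v, if_pos hτ]
        rw [this]
        refine tendsto_const_nhds.congr fun n => ?_
        symm
        simp [indicator_apply, this]
      · obtain ⟨m, hm⟩ := exists_nat_gt (L.tauQ b ω).toReal
        refine tendsto_const_nhds.congr' ?_
        filter_upwards [eventually_ge_atTop m] with n hn
        rw [indicator_of_mem]
        show L.tauQ b ω < _
        rw [ENNReal.lt_ofReal_iff_toReal_lt hτ]
        have : (m:ℝ) ≤ n := by exact_mod_cast hn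
        linarith
  have h2 : Tendsto (fun n : ℕ => ∫⁻ ω in {ω | L.tauQ b ω < ENNReal.ofReal (n + 1)}ᶜ, L.M lam (n + 1) ω ∂ L.P 0)
      atTop (𝓝 0) := by
    have h3 : Tendsto (fun n : ℕ => ENNReal.ofReal (Real.exp (lam * b - L.ψ lam * (n + 1)))) atTop (𝓝 0) := by
      rw [← ENNReal.ofReal_zero]
      refine ENNReal.tendsto_ofReal (Real.tendsto_exp_atBot.comp ?_)
      have h4 : Tendsto (fun n : ℕ => (n:ℝ) + 1) atTop atTop :=
        tendsto_atTop_add_const_right _ _ tendsto_natCast_atTop_atTop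
      have h5 := tendsto_neg_atTop_atBot.comp (h4.const_mul_atTop hψ)
      exact tendsto_atBot_add_const_left _ (lam * b) h5
    exact tendsto_of_tendsto_of_tendsto_of_le_of_le tendsto_const_nhds h3 (fun _ => zero_le)
      fun n => L.h_le hb hl (by positivity)
  have h3 := h1.add h2
  rw [add_zero] at h3
  refine tendsto_nhds_unique h3 (tendsto_const_nhds.congr fun n => ?_)
  exact (L.stop_add hb hl (by positivity)).symm

lemma h_eq {b t lam : ℝ} (hb : 0 < b) (hl : 0 ≤ lam) (hψ : 0 < L.ψ lam) (ht : 0 < t) :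
    ∫⁻ ω in {ω | L.tauQ b ω < ENNReal.ofReal t}ᶜ, L.M lam t ω ∂ L.P 0 =
    ∫⁻ ω in {ω | L.tauQ b ω < ENNReal.ofReal t}ᶜ, L.v b lam (L.ψ lam) ω ∂ L.P 0 := by
  have hEm : MeasurableSet {ω | L.tauQ b ω < ENNReal.ofReal t} :=
    measurableSet_lt (L.measurable_tauQ b) measurable_const
  have h1 := L.stop_add hb hl ht
  have h2 := L.v_total hb hl hψ
  rw [← lintegral_add_compl _ hEm] at h2
  have hfin : ∫⁻ ω in {ω | L.tauQ b ω < ENNReal.ofReal t}, L.v b lam (L.ψ lam) ω ∂ L.P 0 ≠ ⊤ := by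
    intro h
    rw [h] at h1
    simp at h1
  exact (ENNReal.add_right_inj hfin).1 (h1.trans h2.symm)

lemma exists_joint : ∃ Z : ℝ × Ω → ℝ, Measurable Z ∧ ∀ᵐ ω ∂ L.P 0, ∀ t, 0 ≤ t → Z (t, ω) = L.X t ω := by
  classical
  set N := toMeasurable (L.P 0) {ω | ¬ L.Good ω} with hN
  have hNm : MeasurableSet N := measurableSet_toMeasurable _ _
  have hN0 : L.P 0 N = 0 := by
    rw [hN, measure_toMeasurable]; exact L.ae_good
  have hgood : ∀ ω, ω ∉ N → L.Good ω := by
    intro ω hω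
    by_contra h
    exact hω (subset_toMeasurable _ _ h)
  refine ⟨fun p => (fun t ω => if ω ∈ N then (0:ℝ) else L.X t ω) (max p.1 0) p.2,
    joint_meas (fun t ω => if ω ∈ N then (0:ℝ) else L.X t ω) ?_ ?_, ?_⟩
  · intro t
    exact Measurable.ite hNm measurable_const (L.measX t)
  · intro ω t ht
    by_cases h : ω ∈ N
    · simp only [h, if_true]; exact tendsto_const_nhds
    · simp only [h, if_false]; exact (hgood ω h).2.1 t ht
  · have : ∀ᵐ ω ∂ L.P 0, ω ∉ N := measure_eq_zero_iff_ae_notMem.1 hN0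
    filter_upwards [this] with ω hω t ht
    simp [hω, max_eq_left ht]

lemma inner_exp {c : ℝ} (hc : 0 < c) {T : ℝ} (hT : 0 ≤ T) :
    ∫⁻ t in Ioc 0 T, ENNReal.ofReal (Real.exp (c * t)) = ENNReal.ofReal ((Real.exp (c * T) - 1) / c) := by
  rw [← ofReal_integral_eq_lintegral_ofReal]
  · congr 1
    rw [← intervalIntegral.integral_of_le hT]
    rw [intervalIntegral.integral_comp_mul_left (fun x => Real.exp x) hc.ne', integral_exp]
    simp [div_eq_inv_mul]
  · exact (Continuous.integrableOn_Icc (by fun_prop)).mono_set Ioc_subset_Icc_self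
  · exact ae_of_all _ fun t => (Real.exp_pos _).le

/-- killed time-space density -/
def dens (b q : ℝ) (p : ℝ × Ω) : ℝ≥0∞ :=
  if ENNReal.ofReal p.1 ≤ L.tauQ b p.2 then ENNReal.ofReal (Real.exp (-q * p.1)) else 0

lemma measurable_dens (b q : ℝ) : Measurable (L.dens b q) := by
  unfold dens
  have : Measurable (fun p : ℝ × Ω => L.tauQ b p.2) := (L.measurable_tauQ b).comp measurable_snd
  refine Measurable.ite (measurableSet_le (by fun_prop) this) (by fun_prop) measurable_const

/-- killed resolvent measure -/
def R (b q : ℝ) (Z : ℝ × Ω → ℝ) : Measure ℝ :=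
  (((volume.restrict (Ioi (0:ℝ))).prod (L.P 0)).withDensity (L.dens b q)).map Z

lemma R_laplace {b q lam : ℝ} (hb : 0 < b) (hq : 0 < q) (hlam : L.Φ q < lam) {Z : ℝ × Ω → ℝ} (hZ : Measurable Z)
    (hZX : ∀ᵐ ω ∂ L.P 0, ∀ t, 0 ≤ t → Z (t, ω) = L.X t ω) :
    ∫⁻ y, ENNReal.ofReal (Real.exp (lam * y)) ∂ (L.R b q Z) =
      ENNReal.ofReal ((Real.exp ((lam - L.Φ q) * b) - 1) / (L.ψ lam - q)) := by
  have hprob := L.probP 0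
  obtain ⟨hΦ0, hΦ1, hΦ2⟩ := L.Phi_spec hq
  have hψq := hΦ2 lam hlam
  have hl : 0 ≤ lam := hΦ0.le.trans hlam.le
  have hψ : 0 < L.ψ lam := hq.trans hψq
  set c := L.ψ lam - q with hc
  have hc0 : 0 < c := by linarith
  have hτm := L.measurable_tauQ b
  set K := ∫⁻ y, ENNReal.ofReal (Real.exp (lam * y)) ∂ (L.R b q Z) with hK
  have e1 : K = ∫⁻ t in Ioi (0:ℝ), ∫⁻ ω, L.dens b q (t, ω) * ENNReal.ofReal (Real.exp (lam * Z (t, ω))) ∂ L.P 0 := by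
    rw [hK, R, lintegral_map (by fun_prop) hZ, lintegral_withDensity_eq_lintegral_mul _ (L.measurable_dens b q) (by fun_prop)]
    rw [lintegral_prod]
    · rfl
    · exact ((L.measurable_dens b q).mul (by fun_prop)).aemeasurable
  have e2 : ∀ t ∈ Ioi (0:ℝ), ∫⁻ ω, L.dens b q (t, ω) * ENNReal.ofReal (Real.exp (lam * Z (t, ω))) ∂ L.P 0 =
      ∫⁻ ω, (if ENNReal.ofReal t ≤ L.tauQ b ω then ENNReal.ofReal (Real.exp (c * t)) else 0) * L.v b lam (L.ψ lam) ω ∂ L.P 0 := by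
    intro t ht
    have hEm : MeasurableSet {ω | L.tauQ b ω < ENNReal.ofReal t} :=
      measurableSet_lt (L.measurable_tauQ b) measurable_const
    have h := L.h_eq hb hl hψ ht
    have hfac : ∀ g : Ω → ℝ≥0∞, ∫⁻ ω, (if ENNReal.ofReal t ≤ L.tauQ b ω then ENNReal.ofReal (Real.exp (c * t)) else 0) * g ω ∂ L.P 0
        = ENNReal.ofReal (Real.exp (c * t)) * ∫⁻ ω in {ω | L.tauQ b ω < ENNReal.ofReal t}ᶜ, g ω ∂ L.P 0 := by
      intro g
      rw [← lintegral_indicator hEm.compl, ← lintegral_const_mul' _ _ ENNReal.ofReal_ne_top]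
      refine lintegral_congr fun ω => ?_
      by_cases hω : ENNReal.ofReal t ≤ L.tauQ b ω
      · have : ω ∈ {ω | L.tauQ b ω < ENNReal.ofReal t}ᶜ := not_lt.2 hω
        rw [if_pos hω, indicator_of_mem this]
      · have : ω ∉ {ω | L.tauQ b ω < ENNReal.ofReal t}ᶜ := fun h => hω (not_lt.1 h)
        rw [if_neg hω, indicator_of_notMem this]; simp
    rw [hfac, ← h, ← hfac]
    refine lintegral_congr_ae ?_
    filter_upwards [hZX] with ω hω
    rw [hω t (le_of_lt ht), dens]
    split_ifs
    · rw [M, ← ENNReal.ofReal_mul (Real.exp_pos _).le, ← ENNReal.ofReal_mul (Real.exp_pos _).le,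
        ← Real.exp_add, ← Real.exp_add]
      congr 2
      rw [hc]; ring
    · simp
  have e3 : K = ∫⁻ ω, (∫⁻ t in Ioi (0:ℝ), (if ENNReal.ofReal t ≤ L.tauQ b ω then ENNReal.ofReal (Real.exp (c * t)) else 0) * L.v b lam (L.ψ lam) ω) ∂ L.P 0 := by
    rw [e1, setLIntegral_congr_fun measurableSet_Ioi e2]
    rw [lintegral_lintegral_swap]
    have hv := L.measurable_v b lam (L.ψ lam)
    refine Measurable.aemeasurable (Measurable.mul ?_ (hv.comp measurable_snd))
    refine Measurable.ite (measurableSet_le (by fun_prop) (hτm.comp measurable_snd)) (by fun_prop) measurable_const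
  have e4 : ∀ ω, ENNReal.ofReal c * (∫⁻ t in Ioi (0:ℝ), (if ENNReal.ofReal t ≤ L.tauQ b ω then ENNReal.ofReal (Real.exp (c * t)) else 0) * L.v b lam (L.ψ lam) ω)
      + L.v b lam (L.ψ lam) ω = L.v b lam q ω := by
    intro ω
    by_cases hτ : L.tauQ b ω = ⊤
    · simp [v, hτ]
    have hvfin : L.v b lam (L.ψ lam) ω ≠ ⊤ := by
      rw [v, if_neg hτ]; exact ENNReal.ofReal_ne_top
    rw [lintegral_mul_const' _ _ hvfin]
    set τ := (L.tauQ b ω).toReal with hτd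
    have hτ0 : 0 ≤ τ := ENNReal.toReal_nonneg
    have : ∫⁻ t in Ioi (0:ℝ), (if ENNReal.ofReal t ≤ L.tauQ b ω then ENNReal.ofReal (Real.exp (c * t)) else 0) =
        ENNReal.ofReal ((Real.exp (c * τ) - 1) / c) := by
      rw [← inner_exp hc0 hτ0, ← lintegral_indicator measurableSet_Ioi, ← lintegral_indicator measurableSet_Ioc]
      refine lintegral_congr fun t => ?_
      simp only [indicator_apply, mem_Ioi, mem_Ioc, ENNReal.ofReal_le_iff_le_toReal hτ, ← hτd]
      split_ifs <;> first | rfl | (exfalso; tauto)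
    have hexp : 0 ≤ Real.exp (c * τ) - 1 := by
      have := Real.one_le_exp (show 0 ≤ c * τ by positivity)
      linarith
    rw [this, v, v, if_neg hτ, if_neg hτ, ← hτd, ← ENNReal.ofReal_mul (by positivity), ← ENNReal.ofReal_mul hc0.le,
      ← ENNReal.ofReal_add (by positivity) (by positivity)]
    congr 1
    have : Real.exp (lam * b - q * τ) = Real.exp (c * τ) * Real.exp (lam * b - L.ψ lam * τ) := by
      rw [← Real.exp_add, hc]; congr 1; ring
    rw [this]
    field_simp
    ring
  have e5 : ENNReal.ofReal c * K + 1 = ∫⁻ ω, L.v b lam q ω ∂ L.P 0 := by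
    rw [← L.v_total hb hl hψ, e3, ← lintegral_const_mul' _ _ ENNReal.ofReal_ne_top,
      ← lintegral_add_right _ (L.measurable_v _ _ _)]
    exact lintegral_congr e4
  have e6 : ∫⁻ ω, L.v b lam q ω ∂ L.P 0 = ENNReal.ofReal (Real.exp ((lam - L.Φ q) * b)) := by
    have h := L.v_total hb hΦ0.le (by rw [hΦ1]; exact hq)
    rw [hΦ1] at h
    rw [← mul_one (ENNReal.ofReal (Real.exp ((lam - L.Φ q) * b))), ← h, ← lintegral_const_mul' _ _ ENNReal.ofReal_ne_top]
    refine lintegral_congr fun ω => ?_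
    unfold v
    split_ifs
    · simp
    · rw [← ENNReal.ofReal_mul (Real.exp_pos _).le, ← Real.exp_add]
      congr 2; ring
  rw [e6] at e5
  have hKfin : K ≠ ⊤ := by
    intro h
    rw [h, ENNReal.mul_top (by simpa using hc0)] at e5
    simp at e5
  have e7 := congrArg ENNReal.toReal e5
  rw [ENNReal.toReal_add (ENNReal.mul_ne_top ENNReal.ofReal_ne_top hKfin) ENNReal.one_ne_top, ENNReal.toReal_mul,
    ENNReal.toReal_ofReal hc0.le, ENNReal.toReal_ofReal (Real.exp_pos _).le, ENNReal.toReal_one] at e7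
  rw [← ENNReal.ofReal_toReal hKfin]
  congr 1
  rw [eq_div_iff hc0.ne']
  linarith

end SNLevy

namespace SNLevy
open Topology

variable {Ω : Type} [MeasurableSpace Ω] (L : SNLevy Ω)

lemma W_lap {q lam : ℝ} (hq : 0 < q) (hlam : L.Φ q < lam) :
    ∫⁻ y, ENNReal.ofReal (Real.exp (-lam * y)) * ENNReal.ofReal (L.W q y) = ENNReal.ofReal (1 / (L.ψ lam - q)) := by
  obtain ⟨hΦ0, hΦ1, hΦ2⟩ := L.Phi_spec hq
  have hψq := hΦ2 lam hlam
  have h := L.Wlaplace q hq.le lam hlam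
  have hint : Integrable (fun y => Real.exp (-lam * y) * L.W q y) (volume.restrict (Ioi 0)) := by
    by_contra hn
    rw [integral_undef hn] at h
    have : 0 < 1 / (L.ψ lam - q) := by
      have : 0 < L.ψ lam - q := by linarith
      positivity
    linarith
  rw [← h, ofReal_integral_eq_lintegral_ofReal hint
    (ae_of_all _ fun y => mul_nonneg (Real.exp_pos _).le (L.Wnonneg q hq.le y)), ← lintegral_indicator measurableSet_Ioi]
  refine lintegral_congr_ae ?_
  have : ∀ᵐ y : ℝ, y ≠ 0 := by simp [ae_iff]
  filter_upwards [this] with y hy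
  rcases lt_or_gt_of_ne hy with h1 | h1
  · rw [indicator_of_notMem (by simp [h1.le]), L.Wzero q hq.le y h1]; simp
  · rw [indicator_of_mem (by simpa using h1), ENNReal.ofReal_mul (Real.exp_pos _).le]

lemma W_lap_shift {q lam a : ℝ} (hq : 0 < q) (hlam : L.Φ q < lam) :
    ∫⁻ y, ENNReal.ofReal (Real.exp (lam * y)) * ENNReal.ofReal (L.W q (a - y)) =
      ENNReal.ofReal (Real.exp (lam * a)) * ENNReal.ofReal (1 / (L.ψ lam - q)) := by
  rw [← L.W_lap hq hlam, ← lintegral_const_mul' _ _ ENNReal.ofReal_ne_top,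
    ← lintegral_sub_left_eq_self (fun y => ENNReal.ofReal (Real.exp (lam * a)) * (ENNReal.ofReal (Real.exp (-lam * y)) * ENNReal.ofReal (L.W q y))) a]
  refine lintegral_congr fun y => ?_
  have he : ENNReal.ofReal (Real.exp (lam * a)) * ENNReal.ofReal (Real.exp (-lam * (a - y))) =
      ENNReal.ofReal (Real.exp (lam * y)) := by
    rw [← ENNReal.ofReal_mul (Real.exp_pos _).le, ← Real.exp_add]
    congr 2
    ring
  rw [← mul_assoc, he]

lemma eq_of_laplace {α β : Measure ℝ} {Λ : ℝ} (F : ℝ → ℝ)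
    (hα : ∀ l, Λ < l → ∫⁻ y, ENNReal.ofReal (Real.exp (l * y)) ∂α = ENNReal.ofReal (F l))
    (hβ : ∀ l, Λ < l → ∫⁻ y, ENNReal.ofReal (Real.exp (l * y)) ∂β = ENNReal.ofReal (F l)) : α = β := by
  set e : ℝ → ℝ≥0∞ := fun y => ENNReal.ofReal (Real.exp ((Λ + 1) * y)) with he
  have hem : Measurable e := by fun_prop
  have tilt : ∀ κ : Measure ℝ, (∀ l, Λ < l → ∫⁻ y, ENNReal.ofReal (Real.exp (l * y)) ∂κ = ENNReal.ofReal (F l)) →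
      ∀ s, -1 < s → ∫⁻ y, ENNReal.ofReal (Real.exp (s * y)) ∂(κ.withDensity e) = ENNReal.ofReal (F (Λ + 1 + s)) := by
    intro κ hκ s hs
    rw [lintegral_withDensity_eq_lintegral_mul _ hem (by fun_prop), ← hκ _ (by linarith)]
    refine lintegral_congr fun y => ?_
    simp only [Pi.mul_apply, he]
    rw [← ENNReal.ofReal_mul (Real.exp_pos _).le, ← Real.exp_add]
    congr 2; ring
  have fin : ∀ κ : Measure ℝ, (∀ l, Λ < l → ∫⁻ y, ENNReal.ofReal (Real.exp (l * y)) ∂κ = ENNReal.ofReal (F l)) →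
      IsFiniteMeasure (κ.withDensity e) := by
    intro κ hκ
    have := tilt κ hκ 0 (by norm_num)
    simp only [zero_mul, Real.exp_zero, ENNReal.ofReal_one, lintegral_const, one_mul] at this
    exact ⟨by rw [this]; exact ENNReal.ofReal_lt_top⟩
  have int : ∀ κ : Measure ℝ, (∀ l, Λ < l → ∫⁻ y, ENNReal.ofReal (Real.exp (l * y)) ∂κ = ENNReal.ofReal (F l)) →
      ∀ s, -1 < s → Integrable (fun y => Real.exp (s * y)) (κ.withDensity e) := by
    intro κ hκ s hs
    refine ⟨by fun_prop, ?_⟩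
    rw [hasFiniteIntegral_iff_ofReal (ae_of_all _ fun y => (Real.exp_pos _).le), tilt κ hκ s hs]
    exact ENNReal.ofReal_lt_top
  have h1 := fin α hα
  have h2 := fin β hβ
  have heq : α.withDensity e = β.withDensity e := by
    refine ext_of_exp_integrals _ _ 1 one_pos (fun s h _ => int α hα s h) (fun s h _ => int β hβ s h) ?_
    intro s hs _
    rw [integral_eq_lintegral_of_nonneg_ae (ae_of_all _ fun y => (Real.exp_pos _).le) (by fun_prop),
      integral_eq_lintegral_of_nonneg_ae (ae_of_all _ fun y => (Real.exp_pos _).le) (by fun_prop),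
      tilt α hα s hs, tilt β hβ s hs]
  have back : ∀ κ : Measure ℝ, (κ.withDensity e).withDensity (fun y => (e y)⁻¹) = κ := by
    intro κ
    exact withDensity_inv_same hem (ae_of_all _ fun y => by simp [he, Real.exp_pos])
      (ae_of_all _ fun y => ENNReal.ofReal_ne_top)
  rw [← back α, heq, back β]

lemma finite_R {b q : ℝ} (hq : 0 < q) (Z : ℝ × Ω → ℝ) :
    IsFiniteMeasure (((volume.restrict (Ioi (0:ℝ))).prod (L.P 0)).withDensity (L.dens b q)) ∧
    IsFiniteMeasure (L.R b q Z) := by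
  have hprob := L.probP 0
  have : IsFiniteMeasure (((volume.restrict (Ioi (0:ℝ))).prod (L.P 0)).withDensity (L.dens b q)) := by
    constructor
    rw [withDensity_apply _ MeasurableSet.univ, Measure.restrict_univ]
    calc ∫⁻ p, L.dens b q p ∂((volume.restrict (Ioi (0:ℝ))).prod (L.P 0))
        ≤ ∫⁻ p, ENNReal.ofReal (Real.exp (-q * p.1)) ∂((volume.restrict (Ioi (0:ℝ))).prod (L.P 0)) := by
          refine lintegral_mono fun p => ?_
          unfold dens
          split_ifs
          · exact le_rfl
          · exact zero_le
      _ = ∫⁻ t in Ioi (0:ℝ), ENNReal.ofReal (Real.exp (-q * t)) := by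
          rw [lintegral_prod _ (by fun_prop)]
          simp
      _ < ⊤ := by
          have := integrableOn_exp_mul_Ioi (a := -q) (by linarith) 0
          rw [← hasFiniteIntegral_iff_ofReal (ae_of_all _ fun y => (Real.exp_pos _).le)]
          exact this.2
  refine ⟨this, ?_⟩
  unfold R
  infer_instance

lemma R_density {b q : ℝ} (hb : 0 < b) (hq : 0 < q) {Z : ℝ × Ω → ℝ} (hZ : Measurable Z)
    (hZX : ∀ᵐ ω ∂ L.P 0, ∀ t, 0 ≤ t → Z (t, ω) = L.X t ω) (f : ℝ → ℝ) :
    ∫ y, f y ∂(L.R b q Z) =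
      ∫ y, f y * (Real.exp (-(L.Φ q) * b) * L.W q (b - y) - L.W q (-y)) := by
  obtain ⟨hΦ0, hΦ1, hΦ2⟩ := L.Phi_spec hq
  have hfin := (L.finite_R (b := b) hq Z).2
  have hWm := L.Wmeas q hq.le
  set w1 : ℝ → ℝ≥0∞ := fun y => ENNReal.ofReal (L.W q (0 - y)) with hw1
  set w2 : ℝ → ℝ≥0∞ := fun y => ENNReal.ofReal (Real.exp (-(L.Φ q) * b)) * ENNReal.ofReal (L.W q (b - y)) with hw2
  have hw1m : Measurable w1 := by fun_prop
  have hw2m : Measurable w2 := by fun_prop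
  have heq : L.R b q Z + volume.withDensity w1 = volume.withDensity w2 := by
    refine eq_of_laplace (Λ := L.Φ q) (fun l => Real.exp ((l - L.Φ q) * b) / (L.ψ l - q)) ?_ ?_
    · intro l hl
      have hc : 0 < L.ψ l - q := by linarith [hΦ2 l hl]
      have hE : 0 ≤ Real.exp ((l - L.Φ q) * b) - 1 := by
        have := Real.one_le_exp (show 0 ≤ (l - L.Φ q) * b from mul_nonneg (by linarith) hb.le)
        linarith
      rw [lintegral_add_measure, L.R_laplace hb hq hl hZ hZX, lintegral_withDensity_eq_lintegral_mul _ hw1m (by fun_prop)]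
      have := L.W_lap_shift (a := 0) hq hl
      simp only [mul_zero, Real.exp_zero, ENNReal.ofReal_one, one_mul] at this
      simp only [Pi.mul_apply, hw1, mul_comm (ENNReal.ofReal (L.W q _))]
      rw [this, ← ENNReal.ofReal_add (by positivity) (by positivity)]
      congr 1
      field_simp
      ring
    · intro l hl
      have hc : 0 < L.ψ l - q := by linarith [hΦ2 l hl]
      rw [lintegral_withDensity_eq_lintegral_mul _ hw2m (by fun_prop)]
      have h2 : ∀ y, (w2 * fun y => ENNReal.ofReal (Real.exp (l * y))) y = ENNReal.ofReal (Real.exp (-(L.Φ q) * b)) *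
          (ENNReal.ofReal (Real.exp (l * y)) * ENNReal.ofReal (L.W q (b - y))) := by
        intro y
        simp only [Pi.mul_apply, hw2]
        ring
      rw [lintegral_congr h2, lintegral_const_mul' _ _ ENNReal.ofReal_ne_top, L.W_lap_shift hq hl, ← mul_assoc,
        ← ENNReal.ofReal_mul (Real.exp_pos _).le, ← ENNReal.ofReal_mul (by positivity), ← Real.exp_add]
      congr 1
      rw [mul_one_div]
      congr 2
      ring
  have hac : L.R b q Z ≪ volume := by
    have h1 : L.R b q Z ≤ volume.withDensity w2 := by rw [← heq]; exact Measure.le_add_right le_rfl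
    exact (Measure.absolutelyContinuous_of_le h1).trans (withDensity_absolutelyContinuous _ _)
  set r := (L.R b q Z).rnDeriv volume with hr
  have hrm : Measurable r := Measure.measurable_rnDeriv _ _
  have hrR : volume.withDensity r = L.R b q Z := Measure.withDensity_rnDeriv_eq _ _ hac
  rw [← hrR, ← withDensity_add_left hrm] at heq
  have hae : r + w1 =ᵐ[volume] w2 :=
    (withDensity_eq_iff_of_sigmaFinite (hrm.add hw1m).aemeasurable hw2m.aemeasurable).1 heq
  rw [← integral_rnDeriv_smul hac]
  refine integral_congr_ae ?_
  filter_upwards [hae] with y hy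
  have hr_fin : r y ≠ ⊤ := by
    intro h
    simp only [Pi.add_apply, h, top_add, hw2] at hy
    exact ENNReal.mul_ne_top ENNReal.ofReal_ne_top ENNReal.ofReal_ne_top hy.symm
  have h2 := congrArg ENNReal.toReal hy
  simp only [Pi.add_apply, hw1, hw2] at h2
  rw [ENNReal.toReal_add hr_fin ENNReal.ofReal_ne_top, ENNReal.toReal_mul, ENNReal.toReal_ofReal (L.Wnonneg q hq.le _),
    ENNReal.toReal_ofReal (L.Wnonneg q hq.le _), ENNReal.toReal_ofReal (Real.exp_pos _).le, zero_sub] at h2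
  rw [← hr, smul_eq_mul, mul_comm, ← h2]
  ring

end SNLevy

theorem statement11 {Ω : Type} [MeasurableSpace Ω] (L : SNLevy Ω)
    (q : ℝ) (hq : 0 < q) (b : ℝ) (hb : 0 < b)
    (f : ℝ → ℝ) (hfm : Measurable f) (hf0 : ∀ y, 0 ≤ f y) (hfb : ∃ C : ℝ, ∀ y, f y ≤ C) :
    ∫ ω, (∫ t in Set.Ioi (0 : ℝ),
        (if ENNReal.ofReal t < L.tauAbove b ω then Real.exp (-q * t) * f (L.X t ω) else 0))
      ∂ L.P 0
      = ∫ y in Set.Iio b,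
          f y * (Real.exp (-(L.Φ q) * b) * L.W q (b - y) - L.W q (-y)) := by
  have hprob := L.probP 0
  obtain ⟨Z, hZ, hZX⟩ := L.exists_joint
  obtain ⟨hfin1, hfin2⟩ := L.finite_R (b := b) hq Z
  obtain ⟨C, hC⟩ := hfb
  have hR := L.R_density hb hq hZ hZX f
  have hrhs : ∫ y in Set.Iio b, f y * (Real.exp (-(L.Φ q) * b) * L.W q (b - y) - L.W q (-y)) =
      ∫ y, f y * (Real.exp (-(L.Φ q) * b) * L.W q (b - y) - L.W q (-y)) := by
    refine setIntegral_eq_integral_of_ae_compl_eq_zero ?_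
    have : ∀ᵐ y : ℝ, y ≠ b := by simp [ae_iff]
    filter_upwards [this] with y hy hyb
    have hyb' : b < y := lt_of_le_of_ne (not_lt.1 hyb) (Ne.symm hy)
    rw [L.Wzero q hq.le _ (by linarith), L.Wzero q hq.le _ (by linarith)]
    simp
  rw [hrhs, ← hR]
  have hdm := L.measurable_dens b q
  have hdlt : ∀ p, L.dens b q p < ⊤ := by
    intro p
    unfold SNLevy.dens
    split_ifs
    · exact ENNReal.ofReal_lt_top
    · exact ENNReal.zero_lt_top
  have hint0 : Integrable (fun p => f (Z p)) (((volume.restrict (Ioi (0:ℝ))).prod (L.P 0)).withDensity (L.dens b q)) := by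
    refine Integrable.of_bound (hfm.comp hZ).aestronglyMeasurable C (ae_of_all _ fun p => ?_)
    rw [Real.norm_eq_abs, abs_of_nonneg (hf0 _)]
    exact hC _
  have hint := (integrable_withDensity_iff_integrable_smul' hdm (ae_of_all _ hdlt)).1 hint0
  rw [SNLevy.R, integral_map hZ.aemeasurable hfm.aestronglyMeasurable,
    integral_withDensity_eq_integral_toReal_smul hdm (ae_of_all _ hdlt), integral_prod_symm _ hint]
  refine integral_congr_ae ?_
  filter_upwards [hZX, L.ae_good] with ω hω hgood
  refine setIntegral_congr_ae measurableSet_Ioi ?_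
  have : ∀ᵐ t : ℝ, t ≠ (L.tauQ b ω).toReal := by simp [ae_iff]
  filter_upwards [this] with t ht ht0
  rw [SNLevy.tauAbove_eq hgood, hω t (le_of_lt ht0)]
  unfold SNLevy.dens
  have hne : ENNReal.ofReal t ≠ L.tauQ b ω := by
    intro h
    apply ht
    rw [← h, ENNReal.toReal_ofReal (le_of_lt ht0)]
  by_cases hlt : ENNReal.ofReal t < L.tauQ b ω
  · rw [if_pos hlt, if_pos hlt.le, ENNReal.toReal_ofReal (Real.exp_pos _).le, smul_eq_mul]
  · have : ¬ ENNReal.ofReal t ≤ L.tauQ b ω := fun h => hlt (lt_of_le_of_ne h hne)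
    rw [if_neg hlt, if_neg this]
    simp

end
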